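/- Let C, R > 0, let X ⊆ ℝ^d, and let f: ℝ^d × ℝ^d → (0,1) be twice continuously differentiable in its first argument w such that for every w ∈ ℝ^d, x ∈ X, y ∈ {0,1} and every unit vector u ∈ ℝ^d, |uᵀ ∇²_w log( f(w,x)^y (1−f(w,x))^{1−y} ) u| ≤ C. Let H_f = { f(w,·) restricted to X : w ∈ B_2^d(R) } with feature space X. Then r^a_T(H_f) ≤ (d/2)·log( 2CR²T/d + 2 ) + d/2 + log 2. -/

import Mathlib

open Set MeasureTheory

/-- Logarithmic loss with values in `EReal`. -/
noncomputable def logLoss (p : ℝ) (y : Bool) : EReal :=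
  if y then (if p = 0 then ⊤ else (((-Real.log p : ℝ)) : EReal))
  else (if p = 1 then ⊤ else (((-Real.log (1 - p) : ℝ)) : EReal))

noncomputable def lossSum (ps : List ℝ) (ys : List Bool) : EReal :=
  (List.zipWith logLoss ps ys).sum

noncomputable def expertLoss {X : Type*} (h : X → ℝ) (xs : List X) (ys : List Bool) : EReal :=
  (List.zipWith (fun x y => logLoss (h x) y) xs ys).sum

noncomputable def pointwiseRegret {X : Type*} (H : Set (X → ℝ))
    (xs : List X) (ps : List ℝ) (ys : List Bool) : EReal :=
  lossSum ps ys - ⨅ h ∈ H, expertLoss h xs ys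

noncomputable def seqRegretAux {X : Type*} (H : Set (X → ℝ)) :
    ℕ → List X → List ℝ → List Bool → EReal
  | 0, xs, ps, ys => pointwiseRegret H xs ps ys
  | n+1, xs, ps, ys =>
      ⨆ x : X, ⨅ p : Set.Icc (0:ℝ) 1, ⨆ y : Bool,
        seqRegretAux H n (xs ++ [x]) (ps ++ [(p : ℝ)]) (ys ++ [y])

/-- Sequential (agnostic) minimax regret `r^a_T(H)`. -/
noncomputable def seqRegret {X : Type*} (H : Set (X → ℝ)) (T : ℕ) : EReal :=
  seqRegretAux H T [] [] []

/-- The likelihood of the labels `ys` when the label of `x` is Bernoulli with mean `h x`. -/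
noncomputable def likelihood {X : Type*} (h : X → ℝ) (xs : List X) (ys : List Bool) : ℝ :=
  (List.zipWith (fun x y => if y then h x else 1 - h x) xs ys).prod

theorem likelihood_cons {X : Type*} (h : X → ℝ) (x : X) (xs : List X) (y : Bool)
    (ys : List Bool) :
    likelihood h (x :: xs) (y :: ys) = (if y then h x else 1 - h x) * likelihood h xs ys := by
  simp [likelihood]

theorem likelihood_concat {X : Type*} (h : X → ℝ) (x : X) {xs : List X} (y : Bool)
    {ys : List Bool} (hl : xs.length = ys.length) :
    likelihood h (xs ++ [x]) (ys ++ [y]) = likelihood h xs ys * (if y then h x else 1 - h x) := by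
  simp [likelihood, List.zipWith_append hl]

theorem likelihood_mem_Ioc {X : Type*} {h : X → ℝ} (hh : ∀ x, h x ∈ Set.Ioo (0 : ℝ) 1)
    (xs : List X) (ys : List Bool) : likelihood h xs ys ∈ Set.Ioc (0 : ℝ) 1 := by
  induction xs generalizing ys with
  | nil => simp [likelihood]
  | cons x xs ih =>
    cases ys with
    | nil => simp [likelihood]
    | cons y ys =>
      obtain ⟨h0, h1⟩ := hh x
      obtain ⟨i0, i1⟩ := ih ys
      rw [likelihood_cons]
      have hy : 0 < (if y then h x else 1 - h x) ∧ (if y then h x else 1 - h x) ≤ 1 := by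
        cases y <;> simp <;> constructor <;> linarith
      exact ⟨mul_pos hy.1 i0, mul_le_one₀ hy.2 i0.le i1⟩

theorem continuous_likelihood {X V : Type*} [TopologicalSpace V] {f : V → X → ℝ}
    (hf : ∀ x, Continuous fun w => f w x) (xs : List X) (ys : List Bool) :
    Continuous fun w => likelihood (f w) xs ys := by
  induction xs generalizing ys with
  | nil => simpa [likelihood] using continuous_const
  | cons x xs ih =>
    cases ys with
    | nil => simpa [likelihood] using continuous_const
    | cons y ys =>
      simp only [likelihood_cons]
      refine Continuous.mul ?_ (ih ys)
      cases y
      · exact continuous_const.sub (hf x)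
      · simpa using hf x

theorem expertLoss_eq_neg_log_likelihood {X : Type*} {h : X → ℝ}
    (hh : ∀ x, h x ∈ Set.Ioo (0 : ℝ) 1) (xs : List X) (ys : List Bool) :
    expertLoss h xs ys = ((-Real.log (likelihood h xs ys) : ℝ) : EReal) := by
  induction xs generalizing ys with
  | nil => simp [likelihood, expertLoss]
  | cons x xs ih =>
    cases ys with
    | nil => simp [likelihood, expertLoss]
    | cons y ys =>
      obtain ⟨h0, h1⟩ := hh x
      have hy : (if y then h x else 1 - h x) ≠ 0 := by
        cases y <;> simp <;> linarith
      have hloss : logLoss (h x) y =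
          ((-Real.log (if y then h x else 1 - h x) : ℝ) : EReal) := by
        cases y
        · simp [logLoss, h1.ne]
        · simp [logLoss, h0.ne']
      have hcons : expertLoss h (x :: xs) (y :: ys) = logLoss (h x) y + expertLoss h xs ys := by
        simp [expertLoss]
      rw [hcons, ih, hloss, likelihood_cons,
        Real.log_mul hy (likelihood_mem_Ioc hh xs ys).1.ne', ← EReal.coe_add, neg_add]

theorem lossSum_concat {ps : List ℝ} {ys : List Bool} (hl : ps.length = ys.length)
    (p : ℝ) (y : Bool) : lossSum (ps ++ [p]) (ys ++ [y]) = lossSum ps ys + logLoss p y := by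
  simp [lossSum, List.zipWith_append hl]

/-- Predicting with the conditional probabilities of a (not necessarily normalized) positive
measure `Z` on label sequences bounds the minimax regret by the worst-case log-ratio. -/
theorem seqRegret_le_of_mixture {X : Type*} (H : Set (X → ℝ)) (T : ℕ) (B : ℝ)
    (Z : List X → List Bool → ℝ) (hpos : ∀ xs ys, 0 < Z xs ys)
    (hsum : ∀ xs ys, xs.length = ys.length → ∀ x,
      Z (xs ++ [x]) (ys ++ [true]) + Z (xs ++ [x]) (ys ++ [false]) = Z xs ys)
    (hB : ∀ xs ys, xs.length = T → ys.length = T → ∀ h ∈ H,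
      ((Real.log (Z [] []) - Real.log (Z xs ys) - B : ℝ) : EReal) ≤ expertLoss h xs ys) :
    seqRegret H T ≤ (B : EReal) := by
  have key : ∀ (n : ℕ) (xs : List X) (ps : List ℝ) (ys : List Bool),
      xs.length = ys.length → ps.length = ys.length → ys.length + n = T →
      lossSum ps ys = ((Real.log (Z [] []) - Real.log (Z xs ys) : ℝ) : EReal) →
      seqRegretAux H n xs ps ys ≤ (B : EReal) := by
    intro n
    induction n with
    | zero =>
      intro xs ps ys hxs hps hn hloss
      have hle : ((Real.log (Z [] []) - Real.log (Z xs ys) - B : ℝ) : EReal) ≤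
          ⨅ h ∈ H, expertLoss h xs ys :=
        le_iInf₂ fun h hh => hB xs ys (by omega) (by omega) h hh
      have := EReal.sub_le_sub
        (le_refl ((Real.log (Z [] []) - Real.log (Z xs ys) : ℝ) : EReal)) hle
      rw [← EReal.coe_sub, sub_sub_cancel] at this
      rwa [seqRegretAux, pointwiseRegret, hloss]
    | succ n ih =>
      intro xs ps ys hxs hps hn hloss
      rw [seqRegretAux]
      refine iSup_le fun x => ?_
      have hs := hsum xs ys hxs x
      have h1 := hpos (xs ++ [x]) (ys ++ [true])
      have h0 := hpos (xs ++ [x]) (ys ++ [false])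
      have hZ := hpos xs ys
      set p : ℝ := Z (xs ++ [x]) (ys ++ [true]) / Z xs ys with hp
      have hp0 : 0 < p := div_pos h1 hZ
      have hq : 1 - p = Z (xs ++ [x]) (ys ++ [false]) / Z xs ys := by
        rw [hp, eq_div_iff hZ.ne', sub_mul, div_mul_cancel₀ _ hZ.ne']
        linarith
      have hq0 : 0 < 1 - p := hq ▸ div_pos h0 hZ
      refine iInf_le_of_le ⟨p, hp0.le, by linarith⟩ (iSup_le fun y => ?_)
      refine ih _ _ _ (by simp [hxs]) (by simp [hps]) (by simp; omega) ?_
      have hlog : logLoss p y =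
          ((Real.log (Z xs ys) - Real.log (Z (xs ++ [x]) (ys ++ [y])) : ℝ) : EReal) := by
        cases y
        · simp only [logLoss, Bool.false_eq_true, if_false]
          rw [if_neg (by linarith), hq, Real.log_div h0.ne' hZ.ne', neg_sub]
        · simp only [logLoss, if_true]
          rw [if_neg hp0.ne', hp, Real.log_div h1.ne' hZ.ne', neg_sub]
      rw [lossSum_concat hps, hloss, hlog, ← EReal.coe_add]
      congr 1
      ring
  exact key T [] [] [] rfl rfl (by simp) (by simp [lossSum])

/-- A lower bound on the second derivative along every direction bounds the symmetric second
difference from below. -/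
theorem two_mul_le_add_of_iteratedFDeriv_two_ge {V : Type*} [NormedAddCommGroup V]
    [NormedSpace ℝ V] {h : V → ℝ} (hh : ContDiff ℝ 2 h) {C : ℝ}
    (hC : ∀ w u : V, ‖u‖ = 1 → -C ≤ iteratedFDeriv ℝ 2 h w ![u, u]) (w v : V) :
    2 * h w - C * ‖v‖ ^ 2 ≤ h (w + v) + h (w - v) := by
  have hbound : ∀ z, -C * ‖v‖ ^ 2 ≤ fderiv ℝ (fderiv ℝ h) z v v := by
    intro z
    rcases eq_or_ne v 0 with rfl | hv
    · simp
    have hv' : ‖v‖ ≠ 0 := norm_ne_zero_iff.mpr hv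
    have hu := hC z (‖v‖⁻¹ • v) (by rw [norm_smul, norm_inv, norm_norm, inv_mul_cancel₀ hv'])
    rw [iteratedFDeriv_two_apply] at hu
    simp only [Matrix.cons_val_zero, Matrix.cons_val_one, map_smul,
      smul_apply, smul_eq_mul] at hu
    calc -C * ‖v‖ ^ 2
        ≤ (‖v‖⁻¹ * (‖v‖⁻¹ * fderiv ℝ (fderiv ℝ h) z v v)) * ‖v‖ ^ 2 := by gcongr
      _ = fderiv ℝ (fderiv ℝ h) z v v := by field_simp
  have hline : ∀ t : ℝ, HasDerivAt (fun t : ℝ => w + t • v) v t := fun t => by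
    simpa using ((hasDerivAt_id t).smul_const v).const_add w
  have hd1 : ∀ t : ℝ, HasDerivAt (fun t : ℝ => h (w + t • v) + C * ‖v‖ ^ 2 / 2 * t ^ 2)
      (fderiv ℝ h (w + t • v) v + C * ‖v‖ ^ 2 * t) t := fun t => by
    have h1 := ((hh.differentiable (by norm_num)) (w + t • v)).hasFDerivAt.comp_hasDerivAt t
      (hline t)
    have h2 := ((hasDerivAt_pow 2 t).const_mul (C * ‖v‖ ^ 2 / 2))
    exact (h1.add h2).congr_deriv (by push_cast; ring)
  have hd2 : ∀ t : ℝ, HasDerivAt (fun t : ℝ => fderiv ℝ h (w + t • v) v + C * ‖v‖ ^ 2 * t)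
      (fderiv ℝ (fderiv ℝ h) (w + t • v) v v + C * ‖v‖ ^ 2) t := fun t => by
    have hdf : Differentiable ℝ (fderiv ℝ h) :=
      (hh.fderiv_right (m := 1) (by norm_num)).differentiable (by norm_num)
    have h1 := (hdf (w + t • v)).hasFDerivAt.comp_hasDerivAt t (hline t)
    have h2 := h1.clm_apply (hasDerivAt_const t v)
    have h3 := (hasDerivAt_id t).const_mul (C * ‖v‖ ^ 2)
    exact (h2.add h3).congr_deriv (by simp)
  have hconv : ConvexOn ℝ Set.univ
      (fun t : ℝ => h (w + t • v) + C * ‖v‖ ^ 2 / 2 * t ^ 2) := by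
    have hderiv : deriv (fun t : ℝ => h (w + t • v) + C * ‖v‖ ^ 2 / 2 * t ^ 2) =
        fun t => fderiv ℝ h (w + t • v) v + C * ‖v‖ ^ 2 * t := funext fun t => (hd1 t).deriv
    refine convexOn_univ_of_deriv2_nonneg (fun t => (hd1 t).differentiableAt) ?_ ?_
    · rw [hderiv]
      exact fun t => (hd2 t).differentiableAt
    · intro t
      rw [Function.iterate_succ, Function.iterate_one, Function.comp_apply, hderiv,
        (hd2 t).deriv]
      linarith [hbound (w + t • v)]
  have := hconv.2 (Set.mem_univ (1 : ℝ)) (Set.mem_univ (-1 : ℝ))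
    (by norm_num : (0 : ℝ) ≤ 1 / 2) (by norm_num : (0 : ℝ) ≤ 1 / 2) (by norm_num)
  norm_num at this
  rw [← sub_eq_add_neg] at this
  linarith

/-- The symmetric second difference of the log-likelihood, bounded along a data sequence. -/
theorem two_mul_log_likelihood_le {X V : Type*} [NormedAddCommGroup V]
    [NormedSpace ℝ V] {f : V → X → ℝ} (hrange : ∀ w x, f w x ∈ Set.Ioo (0 : ℝ) 1)
    (hsmooth : ∀ x, ContDiff ℝ 2 fun w => f w x) {C : ℝ}
    (hhess : ∀ (w : V) (x : X) (y : Bool) (u : V), ‖u‖ = 1 →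
      |iteratedFDeriv ℝ 2
        (fun w' => if y then Real.log (f w' x) else Real.log (1 - f w' x)) w ![u, u]| ≤ C)
    (xs : List X) (ys : List Bool) (hl : xs.length = ys.length) (w v : V) :
    2 * Real.log (likelihood (f w) xs ys) - xs.length * (C * ‖v‖ ^ 2) ≤
      Real.log (likelihood (f (w + v)) xs ys) + Real.log (likelihood (f (w - v)) xs ys) := by
  induction xs generalizing ys with
  | nil => simp [likelihood]
  | cons x xs ih =>
    cases ys with
    | nil => simp at hl
    | cons y ys =>
      have hsm : ContDiff ℝ 2
          (fun w' => if y then Real.log (f w' x) else Real.log (1 - f w' x)) := by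
        cases y
        · simpa using (contDiff_const.sub (hsmooth x)).log
            fun w => (sub_pos.mpr (hrange w x).2).ne'
        · simpa using (hsmooth x).log fun w => (hrange w x).1.ne'
      have hstep := two_mul_le_add_of_iteratedFDeriv_two_ge hsm
        (fun w u hu => (abs_le.mp (hhess w x y u hu)).1) w v
      have hlog : ∀ w, Real.log (likelihood (f w) (x :: xs) (y :: ys)) =
          (if y then Real.log (f w x) else Real.log (1 - f w x)) +
            Real.log (likelihood (f w) xs ys) := fun w => by
        have hy : (if y then f w x else 1 - f w x) ≠ 0 := by
          have := hrange w x
          cases y <;> simp <;> linarith [this.1, this.2]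
        rw [likelihood_cons, Real.log_mul hy (likelihood_mem_Ioc (hrange w) xs ys).1.ne',
          apply_ite Real.log]
      have := ih ys (by simpa using hl)
      rw [hlog, hlog, hlog, List.length_cons]
      push_cast
      linarith

section Gaussian

variable {V : Type*} [NormedAddCommGroup V] [InnerProductSpace ℝ V] [FiniteDimensional ℝ V]
  [MeasurableSpace V] [BorelSpace V]

theorem integrable_exp_neg_mul_sq_norm {b : ℝ} (hb : 0 < b) :
    Integrable fun v : V => Real.exp (-b * ‖v‖ ^ 2) := by
  refine Integrable.of_integral_ne_zero ?_
  rw [GaussianFourier.integral_rexp_neg_mul_sq_norm hb]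
  positivity

/-- Laplace-type lower bound for a Gaussian-weighted integral of `exp ∘ g`, when the symmetric
second differences of `g` at `w` are bounded below. -/
theorem gaussian_mixture_ge {b K : ℝ} (hb : 0 < b) (hK : 0 ≤ K) {g : V → ℝ} (w : V)
    (hint : Integrable fun z => Real.exp (-b * ‖z‖ ^ 2) * Real.exp (g z))
    (hg : ∀ v, 2 * g w - 2 * K * ‖v‖ ^ 2 ≤ g (w + v) + g (w - v)) :
    Real.exp (-b * ‖w‖ ^ 2 + g w) * (Real.pi / (b + K)) ^ (Module.finrank ℝ V / 2 : ℝ) ≤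
      ∫ z : V, Real.exp (-b * ‖z‖ ^ 2) * Real.exp (g z) := by
  set F : V → ℝ := fun z => Real.exp (-b * ‖z‖ ^ 2) * Real.exp (g z) with hF
  have hbK : 0 < b + K := by linarith
  have hadd : ∫ v, F (w + v) = ∫ z, F z := integral_add_left_eq_self F w
  have hsub : ∫ v, F (w - v) = ∫ z, F z := integral_sub_left_eq_self F volume w
  have hiadd : Integrable fun v => F (w + v) := hint.comp_add_left w
  have hisub : Integrable fun v => F (w - v) := hint.comp_sub_left w
  have hpt : ∀ v, 2 * (Real.exp (-b * ‖w‖ ^ 2 + g w) * Real.exp (-(b + K) * ‖v‖ ^ 2)) ≤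
      F (w + v) + F (w - v) := by
    intro v
    have hpar := parallelogram_law_with_norm ℝ w v
    have hamgm : ∀ s t : ℝ, 2 * Real.exp ((s + t) / 2) ≤ Real.exp s + Real.exp t := by
      intro s t
      have hs : Real.exp s = Real.exp (s / 2) ^ 2 := by rw [← Real.exp_nat_mul]; congr 1; ring
      have ht : Real.exp t = Real.exp (t / 2) ^ 2 := by rw [← Real.exp_nat_mul]; congr 1; ring
      rw [hs, ht, add_div, Real.exp_add]
      linarith [sq_nonneg (Real.exp (s / 2) - Real.exp (t / 2))]
    simp only [hF, ← Real.exp_add]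
    refine le_trans ?_ (hamgm _ _)
    gcongr
    nlinarith [hg v]
  have hmono := integral_mono
    (((integrable_exp_neg_mul_sq_norm hbK).const_mul _).const_mul 2) (hiadd.add hisub) hpt
  rw [integral_const_mul, integral_const_mul,
    GaussianFourier.integral_rexp_neg_mul_sq_norm hbK] at hmono
  simp only [Pi.add_apply] at hmono
  rw [integral_add hiadd hisub, hadd, hsub] at hmono
  linarith

end Gaussian

/-- Minimax regret bound obtained from a centred Gaussian prior of precision `2 * b`. -/
theorem seqRegret_boundedHessian_le {X V : Type*} [NormedAddCommGroup V] [InnerProductSpace ℝ V]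
    [FiniteDimensional ℝ V] [MeasurableSpace V] [BorelSpace V] {f : V → X → ℝ}
    (hrange : ∀ w x, f w x ∈ Set.Ioo (0 : ℝ) 1)
    (hsmooth : ∀ x, ContDiff ℝ 2 fun w => f w x) {C R b : ℝ} (hC : 0 ≤ C) (hb : 0 < b)
    (hhess : ∀ (w : V) (x : X) (y : Bool) (u : V), ‖u‖ = 1 →
      |iteratedFDeriv ℝ 2
        (fun w' => if y then Real.log (f w' x) else Real.log (1 - f w' x)) w ![u, u]| ≤ C)
    (T : ℕ) :
    seqRegret {h : X → ℝ | ∃ w ∈ Metric.closedBall (0 : V) R, h = f w} T ≤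
      ((b * R ^ 2 + (Module.finrank ℝ V / 2 : ℝ) * Real.log (1 + T * C / (2 * b)) : ℝ) :
        EReal) := by
  set n : ℝ := (Module.finrank ℝ V / 2 : ℝ) with hn
  have hcont : ∀ x, Continuous fun w => f w x := fun x => (hsmooth x).continuous
  have hint : ∀ xs ys, Integrable fun w : V =>
      Real.exp (-b * ‖w‖ ^ 2) * likelihood (f w) xs ys := by
    intro xs ys
    refine (integrable_exp_neg_mul_sq_norm hb).mul_bdd (c := 1)
      (continuous_likelihood hcont xs ys).aestronglyMeasurable (.of_forall fun w => ?_)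
    have := likelihood_mem_Ioc (hrange w) xs ys
    rw [Real.norm_eq_abs, abs_of_pos this.1]
    exact this.2
  refine seqRegret_le_of_mixture _ T _
    (fun xs ys => ∫ w : V, Real.exp (-b * ‖w‖ ^ 2) * likelihood (f w) xs ys) ?_ ?_ ?_
  · intro xs ys
    have hpos : ∀ w : V, 0 < Real.exp (-b * ‖w‖ ^ 2) * likelihood (f w) xs ys := fun w =>
      mul_pos (Real.exp_pos _) (likelihood_mem_Ioc (hrange w) xs ys).1
    rw [integral_pos_iff_support_of_nonneg (fun w => (hpos w).le) (hint xs ys),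
      Function.support_eq_univ fun w => (hpos w).ne']
    exact isOpen_univ.measure_pos volume Set.univ_nonempty
  · intro xs ys hl x
    rw [← integral_add (hint _ _) (hint _ _)]
    refine integral_congr_ae (.of_forall fun w => ?_)
    simp only [likelihood_concat _ _ _ hl, if_true, Bool.false_eq_true, if_false]
    ring
  · rintro xs ys hxs hys _ ⟨w, hw, rfl⟩
    rw [expertLoss_eq_neg_log_likelihood (hrange w), EReal.coe_le_coe_iff]
    have hexp : ∀ z : V, Real.exp (Real.log (likelihood (f z) xs ys)) = likelihood (f z) xs ys :=
      fun z => Real.exp_log (likelihood_mem_Ioc (hrange z) xs ys).1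
    have hK : 0 ≤ T * C / 2 := by positivity
    have hZ := gaussian_mixture_ge (g := fun z => Real.log (likelihood (f z) xs ys)) hb hK w
      (by simpa only [hexp] using hint xs ys) (fun v => by
        have := two_mul_log_likelihood_le hrange hsmooth hhess xs ys (hxs.trans hys.symm) w v
        rw [hxs] at this
        linarith)
    simp only [hexp] at hZ
    have hlog := Real.log_le_log (by positivity) hZ
    have hbK : 0 < b + T * C / 2 := by linarith
    rw [Real.log_mul (by positivity) (by positivity), Real.log_exp,
      Real.log_rpow (by positivity), Real.log_div Real.pi_ne_zero hbK.ne',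
      ← hn] at hlog
    have hZ0 : Real.log (∫ w : V, Real.exp (-b * ‖w‖ ^ 2) * likelihood (f w) [] []) =
        n * (Real.log Real.pi - Real.log b) := by
      simp only [likelihood, List.zipWith_nil_left, List.prod_nil, mul_one]
      rw [GaussianFourier.integral_rexp_neg_mul_sq_norm hb, Real.log_rpow (by positivity),
        Real.log_div Real.pi_ne_zero hb.ne']
    have hratio : Real.log (1 + T * C / (2 * b)) = Real.log (b + T * C / 2) - Real.log b := by
      rw [← Real.log_div hbK.ne' hb.ne']
      congr 1
      field_simp
    have hwR : b * ‖w‖ ^ 2 ≤ b * R ^ 2 := by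
      have := mem_closedBall_zero_iff.mp hw
      gcongr
    rw [hZ0, hratio]
    linarith

/-- Theorem 4 (ball form): if the Hessian in `w` of
`log (f(w,x)^y (1-f(w,x))^{1-y})` is uniformly bounded by `C` on the feature set
`Xs`, and the parameters range over the Euclidean ball of radius `R`, then
`r^a_T(H_f) ≤ (d/2) log(2CR²T/d + 2) + d/2 + log 2`. -/
theorem seqRegret_boundedHessian_ball_upper (d T : ℕ) (hd : 0 < d) (hT : 0 < T)
    (C R : ℝ) (hC : 0 < C) (hR : 0 < R)
    (Xs : Set (EuclideanSpace ℝ (Fin d)))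
    (f : EuclideanSpace ℝ (Fin d) → EuclideanSpace ℝ (Fin d) → ℝ)
    (hrange : ∀ w x, f w x ∈ Set.Ioo (0:ℝ) 1)
    (hsmooth : ∀ x, ContDiff ℝ 2 (fun w => f w x))
    (hhess : ∀ (w : EuclideanSpace ℝ (Fin d)), ∀ x ∈ Xs, ∀ y : Bool,
      ∀ u : EuclideanSpace ℝ (Fin d), ‖u‖ = 1 →
        |iteratedFDeriv ℝ 2
            (fun w' => if y then Real.log (f w' x) else Real.log (1 - f w' x)) w ![u, u]| ≤ C) :
    seqRegret {h : ↥Xs → ℝ |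
        ∃ w ∈ Metric.closedBall (0 : EuclideanSpace ℝ (Fin d)) R, h = fun x => f w x.1} T ≤
      ((((d : ℝ) / 2) * Real.log (2 * C * R ^ 2 * (T : ℝ) / (d : ℝ) + 2) +
          (d : ℝ) / 2 + Real.log 2 : ℝ) : EReal) := by
  have hd' : (0 : ℝ) < d := Nat.cast_pos.mpr hd
  have hb : 0 < (d : ℝ) / (2 * R ^ 2) := by positivity
  refine (seqRegret_boundedHessian_le (f := fun w (x : Xs) => f w x.1)
    (fun w x => hrange w x.1) (fun x => hsmooth x.1) hC.le hb
    (fun w x y u hu => hhess w x.1 x.2 y u hu) T).trans (EReal.coe_le_coe_iff.mpr ?_)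
  have hbR : (d : ℝ) / (2 * R ^ 2) * R ^ 2 = d / 2 := by field_simp
  have harg : 1 + T * C / (2 * ((d : ℝ) / (2 * R ^ 2))) ≤
      2 * C * R ^ 2 * (T : ℝ) / (d : ℝ) + 2 := by
    have h1 : T * C / (2 * ((d : ℝ) / (2 * R ^ 2))) = C * R ^ 2 * T / d := by field_simp
    have h2 : 2 * C * R ^ 2 * (T : ℝ) / (d : ℝ) = 2 * (C * R ^ 2 * T / d) := by ring
    have h3 : 0 ≤ C * R ^ 2 * T / d := by positivity
    rw [h1, h2]
    linarith
  have hlog := mul_le_mul_of_nonneg_left (Real.log_le_log (by positivity) harg)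
    (half_pos hd').le
  rw [hbR, finrank_euclideanSpace_fin]
  linarith [Real.log_nonneg (by norm_num : (1 : ℝ) ≤ 2)]
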